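/- Let A ⊂ ℝ^{d'} be compact with H_α(A) > 0, 0 < α ≤ d', s > α, and let w be a nonnegative weight bounded above by ‖w‖ on A×A. Then for all N ≥ 2, the minimal weighted Riesz s-energy satisfies E_s^w(A,N) ≤ M_{s,α} ‖w‖ (H^∞_α(A))^{-s/α} N^{1+s/α} for some constant M_{s,α} > 0 depending only on s, α, d'. -/

import Mathlib

open Finset MeasureTheory
open scoped ENNReal

noncomputable def stmt10Energy {d' : ℕ} (s : ℝ)
    (w : EuclideanSpace ℝ (Fin d') → EuclideanSpace ℝ (Fin d') → ℝ)
    {N : ℕ} (x : Fin N → EuclideanSpace ℝ (Fin d')) : ℝ :=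
  ∑ i, ∑ j ∈ Finset.univ.erase i, w (x i) (x j) / dist (x i) (x j) ^ s

/-- The α-dimensional Hausdorff content `H^∞_α(A) = inf { ∑ (diam Gᵢ)^α : A ⊆ ⋃ Gᵢ }`. -/
noncomputable def stmt10Content (d' : ℕ) (α : ℝ) (A : Set (EuclideanSpace ℝ (Fin d'))) : ℝ≥0∞ :=
  ⨅ (G : ℕ → Set (EuclideanSpace ℝ (Fin d'))) (_ : A ⊆ ⋃ i, G i),
    ∑' i, EMetric.diam (G i) ^ α


lemma content_le_finset {d' : ℕ} {α : ℝ} (hα : 0 < α) (A : Set (EuclideanSpace ℝ (Fin d')))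
    {ι : Type*} (u : Finset ι) (G : ι → Set (EuclideanSpace ℝ (Fin d')))
    (h : A ⊆ ⋃ b ∈ u, G b) : stmt10Content d' α A ≤ ∑ b ∈ u, Metric.ediam (G b) ^ α := by
  classical
  let _ : Encodable u := Fintype.toEncodable _
  have h1 := tsum_iUnion_decode₂ (β := u) (fun S : Set (EuclideanSpace ℝ (Fin d')) => Metric.ediam S ^ α)
    (by simp [Metric.ediam_empty, hα]) (fun b : u => G b)
  have h2 : ∑ b ∈ u, Metric.ediam (G b) ^ α = ∑' b : u, Metric.ediam (G b) ^ α := by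
    rw [tsum_fintype, Finset.sum_coe_sort u (fun b => Metric.ediam (G b) ^ α)]
  rw [h2, ← h1]
  refine iInf₂_le_of_le _ ?_ le_rfl
  rw [Encodable.iUnion_decode₂]
  intro a ha
  have := h ha
  simpa using this

lemma content_pos {d' : ℕ} {α : ℝ} (hα : 0 < α) (A : Set (EuclideanSpace ℝ (Fin d')))
    (hA : 0 < μH[α] A) : stmt10Content d' α A ≠ 0 := by
  intro h0
  apply hA.ne'
  rw [Measure.hausdorffMeasure_apply, ← nonpos_iff_eq_zero]
  refine iSup₂_le fun r hr => ?_
  refine ENNReal.le_of_forall_pos_le_add fun ε hε _ => ?_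
  rw [zero_add]
  have hpos : (0 : ℝ≥0∞) < min (ε : ℝ≥0∞) (r ^ α) :=
    lt_min (by exact_mod_cast hε) (ENNReal.rpow_pos_of_nonneg hr hα.le)
  rw [← h0] at hpos
  unfold stmt10Content at hpos
  simp only [iInf_lt_iff] at hpos
  obtain ⟨G, hG, hlt⟩ := hpos
  refine iInf₂_le_of_le G hG (iInf_le_of_le ?_ ?_)
  · intro n
    have h1 : Metric.ediam (G n) ^ α ≤ r ^ α :=
      (ENNReal.le_tsum n).trans (hlt.le.trans (min_le_right _ _))
    exact (ENNReal.rpow_le_rpow_iff hα).1 h1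
  · refine le_trans (ENNReal.tsum_le_tsum fun n => ?_) (hlt.le.trans (min_le_left _ _))
    exact iSup_le fun _ => le_rfl

lemma content_lt_top {d' : ℕ} {α : ℝ} (hα : 0 < α) (A : Set (EuclideanSpace ℝ (Fin d')))
    (hA : IsCompact A) : stmt10Content d' α A ≠ ⊤ := by
  have := content_le_finset hα A ({()} : Finset Unit) (fun _ => A)
    (fun a ha => Set.mem_iUnion₂.2 ⟨(), by simp, ha⟩)
  refine ne_top_of_le_ne_top ?_ this
  simp only [Finset.sum_singleton]
  exact ENNReal.rpow_ne_top_of_nonneg hα.le hA.isBounded.ediam_ne_top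

open scoped Classical in
/-- Upper regularity of a finite set at scale `δ`. -/
def GoodSet {d' : ℕ} (α δ : ℝ) (P : Finset (EuclideanSpace ℝ (Fin d'))) : Prop :=
  ∀ x r, δ ≤ r → ((P.filter (fun p => p ∈ Metric.closedBall x r)).card : ℝ) ≤ (r / δ) ^ α

open scoped Classical in
lemma good_extend {d' : ℕ} {α δ : ℝ} (hα : 0 < α) (hδ : 0 < δ)
    (A : Set (EuclideanSpace ℝ (Fin d'))) (hA : IsCompact A)
    (P : Finset (EuclideanSpace ℝ (Fin d'))) (hP : GoodSet α δ P)
    (hC : 2 * 10 ^ α * δ ^ α * P.card < (stmt10Content d' α A).toReal) :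
    ∃ a ∈ A, a ∉ P ∧ GoodSet α δ (insert a P) := by
  by_contra hcon
  push Not at hcon
  have key : ∀ a : A, ∃ x : EuclideanSpace ℝ (Fin d'), ∃ r : ℝ, δ ≤ r ∧
      (a : EuclideanSpace ℝ (Fin d')) ∈ Metric.closedBall x r ∧
      1 ≤ (P.filter (fun p => p ∈ Metric.closedBall x r)).card ∧
      r ^ α ≤ 2 * δ ^ α * (P.filter (fun p => p ∈ Metric.closedBall x r)).card := by
    rintro ⟨a, ha⟩
    by_cases haP : a ∈ P
    · have h1 : 1 ≤ (P.filter (fun p => p ∈ Metric.closedBall a δ)).card := by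
        apply Finset.card_pos.2
        exact ⟨a, by simp [haP, hδ.le]⟩
      refine ⟨a, δ, le_rfl, by simp [hδ.le], h1, ?_⟩
      have h2 : (1:ℝ) ≤ (P.filter (fun p => p ∈ Metric.closedBall a δ)).card := by exact_mod_cast h1
      have : 0 < δ ^ α := Real.rpow_pos_of_pos hδ α
      nlinarith
    · have := hcon a ha haP
      unfold GoodSet at this
      push Not at this
      obtain ⟨x, r, hr, hlt⟩ := this
      have hPx := hP x r hr
      have hr1 : 1 ≤ (r / δ) ^ α :=
        Real.one_le_rpow ((one_le_div hδ).2 hr) hα.le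
      rw [Finset.filter_insert] at hlt
      by_cases hax : a ∈ Metric.closedBall x r
      · rw [if_pos hax, Finset.card_insert_of_notMem (by simp [haP])] at hlt
        push_cast at hlt
        have h1 : 1 ≤ (P.filter (fun p => p ∈ Metric.closedBall x r)).card := by
          by_contra h
          have h0 : (P.filter (fun p => p ∈ Metric.closedBall x r)).card = 0 := by omega
          rw [h0] at hlt
          norm_num at hlt
          linarith
        refine ⟨x, r, hr, hax, h1, ?_⟩
        have h2 : (1:ℝ) ≤ (P.filter (fun p => p ∈ Metric.closedBall x r)).card := by exact_mod_cast h1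
        have h3 : 0 < δ ^ α := Real.rpow_pos_of_pos hδ α
        rw [Real.div_rpow (hδ.le.trans hr) hδ.le, div_lt_iff₀ h3] at hlt
        nlinarith
      · rw [if_neg hax] at hlt
        linarith
  choose x r hr hax h1 hle using key
  have hR : ∀ a, r a ≤ (2 * δ ^ α * P.card) ^ α⁻¹ := by
    intro a
    have h0 : 0 ≤ r a := hδ.le.trans (hr a)
    rw [Real.le_rpow_inv_iff_of_pos h0 (by positivity) hα]
    refine (hle a).trans ?_
    gcongr
    exact Finset.filter_subset _ _
  obtain ⟨u, -, hdisj, hcov⟩ := Vitali.exists_disjoint_subfamily_covering_enlargement_closedBall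
    (Set.univ : Set A) x r _ (fun a _ => hR a) 5 (by norm_num)
  let F : A → Finset (EuclideanSpace ℝ (Fin d')) :=
    fun a => P.filter (fun p => p ∈ Metric.closedBall (x a) (r a))
  have hFd : u.PairwiseDisjoint F := by
    intro a ha b hb hab
    have := hdisj ha hb hab
    refine Finset.disjoint_left.2 fun p hp hq => ?_
    exact Set.disjoint_left.1 this (Finset.mem_filter.1 hp).2 (Finset.mem_filter.1 hq).2
  have hFinj : Set.InjOn F u := by
    intro a ha b hb hab
    by_contra hne
    have := hFd ha hb hne
    obtain ⟨p, hp⟩ := Finset.card_pos.1 (h1 a)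
    exact Finset.disjoint_left.1 this hp (hab ▸ hp)
  have hfin : u.Finite := by
    refine Set.Finite.of_finite_image (f := F) ?_ hFinj
    refine Set.Finite.subset (P.powerset.finite_toSet) ?_
    rintro _ ⟨a, -, rfl⟩
    exact Finset.mem_coe.2 (Finset.mem_powerset.2 (Finset.filter_subset _ _))
  let v := hfin.toFinset
  have hsum : ∑ a ∈ v, (F a).card ≤ P.card := by
    rw [← Finset.card_biUnion]
    · refine Finset.card_le_card ?_
      intro p hp
      obtain ⟨a, -, h⟩ := Finset.mem_biUnion.1 hp
      exact (Finset.mem_filter.1 h).1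
    · intro a ha b hb hab
      exact hFd (by simpa [v] using ha) (by simpa [v] using hb) hab
  have hcont := content_le_finset hα A v (fun a => Metric.closedBall (x a) (5 * r a)) (by
    intro a ha
    obtain ⟨b, hb, hsub⟩ := hcov ⟨a, ha⟩ (Set.mem_univ _)
    simp only [Set.mem_iUnion]
    exact ⟨b, by simpa [v] using hb, hsub (hax ⟨a, ha⟩)⟩)
  have hbound : ∑ b ∈ v, Metric.ediam (Metric.closedBall (x b) (5 * r b)) ^ α
      ≤ ENNReal.ofReal (∑ b ∈ v, (10 * r b) ^ α) := by
    rw [ENNReal.ofReal_sum_of_nonneg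
      (fun b _ => Real.rpow_nonneg (by have := hr b; linarith) _)]
    refine Finset.sum_le_sum fun b _ => ?_
    have h0 : 0 ≤ r b := hδ.le.trans (hr b)
    rw [← ENNReal.ofReal_rpow_of_nonneg (by linarith) hα.le]
    refine ENNReal.rpow_le_rpow ?_ hα.le
    have : Metric.closedBall (x b) (5 * r b) = Metric.closedEBall (x b) (ENNReal.ofReal (5 * r b)) := by
      rw [Metric.closedEBall_ofReal (by linarith)]
    rw [this]
    refine Metric.ediam_closedEBall_le.trans ?_
    rw [show (2:ℝ≥0∞) = ENNReal.ofReal 2 by simp, ← ENNReal.ofReal_mul (by norm_num)]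
    exact ENNReal.ofReal_le_ofReal (by linarith)
  have hfinal : (stmt10Content d' α A).toReal ≤ ∑ b ∈ v, (10 * r b) ^ α :=
    ENNReal.toReal_le_of_le_ofReal
      (Finset.sum_nonneg fun b _ => Real.rpow_nonneg (by have := hr b; linarith) _)
      (hcont.trans hbound)
  have hlast : ∑ b ∈ v, (10 * r b) ^ α ≤ 2 * 10 ^ α * δ ^ α * P.card := by
    calc ∑ b ∈ v, (10 * r b) ^ α ≤ ∑ b ∈ v, 10 ^ α * (2 * δ ^ α * (F b).card) := by
          refine Finset.sum_le_sum fun b _ => ?_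
          rw [Real.mul_rpow (by norm_num) (hδ.le.trans (hr b))]
          gcongr
          exact hle b
      _ = 2 * 10 ^ α * δ ^ α * ((∑ b ∈ v, (F b).card : ℕ) : ℝ) := by
          push_cast
          rw [Finset.mul_sum]
          refine Finset.sum_congr rfl fun b _ => by ring
      _ ≤ _ := by
          gcongr
  linarith

lemma good_exists {d' : ℕ} {α δ : ℝ} (hα : 0 < α) (hδ : 0 < δ)
    (A : Set (EuclideanSpace ℝ (Fin d'))) (hA : IsCompact A) (N : ℕ)
    (hC : 2 * 10 ^ α * δ ^ α * N ≤ (stmt10Content d' α A).toReal) :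
    ∀ n, n ≤ N → ∃ P : Finset (EuclideanSpace ℝ (Fin d')), (P : Set _) ⊆ A ∧ P.card = n ∧
      GoodSet α δ P := by
  classical
  intro n
  induction n with
  | zero =>
    intro _
    refine ⟨∅, by simp, by simp, ?_⟩
    intro x r hr
    simp only [Finset.filter_empty, Finset.card_empty, Nat.cast_zero]
    exact Real.rpow_nonneg (div_nonneg (hδ.le.trans hr) hδ.le) _
  | succ n ih =>
    intro hn
    obtain ⟨P, hPA, hPn, hP⟩ := ih (by omega)
    have : 2 * 10 ^ α * δ ^ α * P.card < (stmt10Content d' α A).toReal := by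
      refine lt_of_lt_of_le ?_ hC
      have : (P.card : ℝ) < N := by rw [hPn]; exact_mod_cast hn
      have h3 : 0 < δ ^ α := Real.rpow_pos_of_pos hδ α
      gcongr
    obtain ⟨a, ha, haP, hg⟩ := good_extend hα hδ A hA P hP this
    refine ⟨insert a P, ?_, ?_, hg⟩
    · intro p hp
      rcases Finset.mem_insert.1 (Finset.mem_coe.1 hp) with rfl | h
      · exact ha
      · exact hPA h
    · rw [Finset.card_insert_of_notMem haP, hPn]

lemma good_energy {d' : ℕ} {α δ s : ℝ} (hα : 0 < α) (hδ : 0 < δ) (hs : α < s)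
    (P : Finset (EuclideanSpace ℝ (Fin d'))) (hP : GoodSet α δ P)
    (p : EuclideanSpace ℝ (Fin d')) (hp : p ∈ P) [DecidableEq (EuclideanSpace ℝ (Fin d'))] :
    ∑ q ∈ P.erase p, 1 / dist p q ^ s ≤ 2 ^ α / (1 - 2 ^ (α - s)) * δ ^ (-s) := by
  classical
  have hsep : ∀ q ∈ P.erase p, δ < dist p q := by
    intro q hq
    by_contra! h
    have h1 := hP p δ le_rfl
    rw [div_self hδ.ne', Real.one_rpow] at h1
    have h2 : 1 < (P.filter (fun q => q ∈ Metric.closedBall p δ)).card := by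
      rw [Finset.one_lt_card]
      refine ⟨p, by simp [hp, hδ.le], q, ?_, (Finset.ne_of_mem_erase hq).symm⟩
      simp [Finset.mem_of_mem_erase hq, dist_comm q p, h]
    have h3 : (1:ℝ) < (P.filter (fun q => q ∈ Metric.closedBall p δ)).card := by exact_mod_cast h2
    linarith
  have hk : ∀ q, ∃ k : ℕ, q ∈ P.erase p → 2 ^ k * δ ≤ dist p q ∧ dist p q ≤ 2 ^ (k+1) * δ := by
    intro q
    by_cases hq : q ∈ P.erase p
    · obtain ⟨k, hk1, hk2⟩ := exists_nat_pow_near (x := dist p q / δ) (y := (2:ℝ))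
        ((one_le_div hδ).2 (hsep q hq).le) (by norm_num)
      refine ⟨k, fun _ => ⟨(le_div_iff₀ hδ).1 hk1, ((div_lt_iff₀ hδ).1 hk2).le⟩⟩
    · exact ⟨0, fun h => absurd h hq⟩
  choose k hk using hk
  let K := (P.erase p).sup k + 1
  have hmaps : ∀ q ∈ P.erase p, k q ∈ Finset.range K := fun q hq =>
    Finset.mem_range.2 (Nat.lt_succ_of_le (Finset.le_sup (f := k) hq))
  rw [← Finset.sum_fiberwise_of_maps_to hmaps]
  have hq0 : (0:ℝ) < 2 ^ (α - s) := by positivity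
  have hq1 : (2:ℝ) ^ (α - s) < 1 := Real.rpow_lt_one_of_one_lt_of_neg (by norm_num) (by linarith)
  have hterm : ∀ m ∈ Finset.range K, ∑ q ∈ P.erase p with k q = m, 1 / dist p q ^ s
      ≤ 2 ^ α * δ ^ (-s) * (2 ^ (α - s)) ^ m := by
    intro m _
    have hcard : (((P.erase p).filter (fun q => k q = m)).card : ℝ) ≤ (2 ^ (m+1)) ^ α := by
      have h1 := hP p (2 ^ (m+1) * δ) (le_mul_of_one_le_left hδ.le (one_le_pow₀ (by norm_num)))
      rw [mul_div_cancel_right₀ _ hδ.ne'] at h1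
      refine le_trans ?_ h1
      refine Nat.cast_le.2 ?_
      refine Finset.card_le_card fun q hq => ?_
      obtain ⟨hq, hqm⟩ := Finset.mem_filter.1 hq
      refine Finset.mem_filter.2 ⟨Finset.mem_of_mem_erase hq, ?_⟩
      rw [Metric.mem_closedBall, dist_comm, ← hqm]
      exact (hk q hq).2
    have hb : ∀ q ∈ (P.erase p).filter (fun q => k q = m), 1 / dist p q ^ s ≤ 1 / (2 ^ m * δ) ^ s := by
      intro q hq
      obtain ⟨hq, hqm⟩ := Finset.mem_filter.1 hq
      have h1 := (hk q hq).1
      rw [hqm] at h1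
      have : 0 < s := hα.trans hs
      gcongr
    refine (Finset.sum_le_card_nsmul _ _ _ hb).trans ?_
    rw [nsmul_eq_mul]
    calc _ ≤ ((2:ℝ) ^ (m+1)) ^ α * (1 / (2 ^ m * δ) ^ s) := by gcongr
      _ = _ := by
        rw [Real.mul_rpow (by positivity) hδ.le, Real.rpow_neg hδ.le, Real.rpow_sub (by norm_num),
          pow_succ, Real.mul_rpow (by positivity) (by norm_num), div_pow,
          ← Real.rpow_natCast_mul (by norm_num), ← Real.rpow_natCast_mul (by norm_num),
          ← Real.rpow_mul_natCast (by norm_num), ← Real.rpow_mul_natCast (by norm_num),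
          mul_comm (m:ℝ) α, mul_comm (m:ℝ) s]
        field_simp
  refine (Finset.sum_le_sum hterm).trans ?_
  rw [← Finset.mul_sum]
  have hgeo : ∑ i ∈ Finset.range K, ((2:ℝ) ^ (α - s)) ^ i ≤ 1 / (1 - 2 ^ (α - s)) := by
    rw [one_div, ← tsum_geometric_of_lt_one hq0.le hq1]
    exact (summable_geometric_of_lt_one hq0.le hq1).sum_le_tsum _ (fun _ _ => by positivity)
  calc _ ≤ 2 ^ α * δ ^ (-s) * (1 / (1 - 2 ^ (α - s))) := by gcongr
    _ = _ := by ring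

theorem stmt_10 (d' : ℕ) (α s : ℝ) (hα0 : 0 < α) (hαd : α ≤ d') (hs : α < s) :
    ∃ M : ℝ, 0 < M ∧
      ∀ (A : Set (EuclideanSpace ℝ (Fin d'))), IsCompact A → 0 < μH[α] A →
      ∀ (w : EuclideanSpace ℝ (Fin d') → EuclideanSpace ℝ (Fin d') → ℝ) (W : ℝ),
        (∀ x y, 0 ≤ w x y) → (∀ x ∈ A, ∀ y ∈ A, w x y ≤ W) →
      ∀ N : ℕ, 2 ≤ N →
        sInf {e : ℝ | ∃ x : Fin N → EuclideanSpace ℝ (Fin d'),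
            Function.Injective x ∧ (∀ i, x i ∈ A) ∧ e = stmt10Energy s w x}
          ≤ M * W * ((stmt10Content d' α A).toReal) ^ (-(s / α)) * (N : ℝ) ^ (1 + s / α) := by
  classical
  have hq1 : (2:ℝ) ^ (α - s) < 1 := Real.rpow_lt_one_of_one_lt_of_neg (by norm_num) (by linarith)
  have hB : (0:ℝ) < 2 ^ α / (1 - 2 ^ (α - s)) := div_pos (by positivity) (by linarith)
  refine ⟨2 ^ α / (1 - 2 ^ (α - s)) * (2 * 10 ^ α) ^ (s / α), by positivity, ?_⟩
  intro A hA hpos w W hw hW N hN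
  have hC0 : 0 < (stmt10Content d' α A).toReal :=
    ENNReal.toReal_pos (content_pos hα0 A hpos) (content_lt_top hα0 A hA)
  set C := (stmt10Content d' α A).toReal with hC
  have hN0 : (0:ℝ) < N := by exact_mod_cast (by omega : 0 < N)
  have hne : A.Nonempty := by
    by_contra h
    rw [Set.not_nonempty_iff_eq_empty.1 h] at hpos
    simp at hpos
  obtain ⟨a0, ha0⟩ := hne
  have hW0 : 0 ≤ W := (hw a0 a0).trans (hW a0 ha0 a0 ha0)
  set δ : ℝ := (C / (2 * 10 ^ α * N)) ^ α⁻¹ with hδd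
  have hδ : 0 < δ := by positivity
  have hδα : δ ^ α = C / (2 * 10 ^ α * N) := Real.rpow_inv_rpow (by positivity) hα0.ne'
  obtain ⟨P, hPA, hPN, hP⟩ := good_exists hα0 hδ A hA N (by
    rw [hδα, ← hC]; apply le_of_eq; field_simp) N le_rfl
  let e := (P.equivFinOfCardEq hPN).symm
  let x : Fin N → EuclideanSpace ℝ (Fin d') := fun i => e i
  have hxinj : Function.Injective x := fun i j h => e.injective (Subtype.ext h)
  have hxA : ∀ i, x i ∈ A := fun i => hPA (e i).2
  refine le_trans (b := stmt10Energy s w x) (csInf_le ⟨0, ?_⟩ ⟨x, hxinj, hxA, rfl⟩) ?_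
  · rintro _ ⟨y, -, -, rfl⟩
    exact Finset.sum_nonneg fun i _ => Finset.sum_nonneg fun j _ =>
      div_nonneg (hw _ _) (Real.rpow_nonneg dist_nonneg _)
  have hinner : ∀ i, ∑ j ∈ Finset.univ.erase i, w (x i) (x j) / dist (x i) (x j) ^ s
      ≤ W * (2 ^ α / (1 - 2 ^ (α - s)) * δ ^ (-s)) := by
    intro i
    have h1 := good_energy hα0 hδ hs P hP (x i) (e i).2
    have him : P.erase (x i) = (Finset.univ.erase i).image x := by
      ext q
      simp only [Finset.mem_erase, Finset.mem_image, Finset.mem_univ, and_true]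
      constructor
      · rintro ⟨hne, hq⟩
        refine ⟨e.symm ⟨q, hq⟩, ?_, by simp [x]⟩
        rintro rfl
        exact hne (by simp [x])
      · rintro ⟨j, hj, rfl⟩
        exact ⟨fun h => hj (hxinj h), (e j).2⟩
    rw [him, Finset.sum_image (fun _ _ _ _ h => hxinj h)] at h1
    refine le_trans ?_ (mul_le_mul_of_nonneg_left h1 hW0)
    rw [Finset.mul_sum]
    refine Finset.sum_le_sum fun j _ => ?_
    rw [mul_one_div]
    exact div_le_div_of_nonneg_right (hW _ (hxA i) _ (hxA j)) (Real.rpow_nonneg dist_nonneg _)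
  refine (Finset.sum_le_sum fun i _ => hinner i).trans (le_of_eq ?_)
  have hδs : δ ^ (-s) = (2 * 10 ^ α) ^ (s / α) * C ^ (-(s / α)) * (N:ℝ) ^ (s / α) := by
    rw [hδd, ← Real.rpow_mul (by positivity), show α⁻¹ * -s = -(s / α) by ring,
      Real.div_rpow hC0.le (by positivity), Real.rpow_neg (x := 2 * 10 ^ α * (N:ℝ)) (by positivity),
      Real.mul_rpow (by positivity) hN0.le]
    field_simp
  rw [Finset.sum_const, Finset.card_univ, Fintype.card_fin, nsmul_eq_mul, hδs,
    Real.rpow_add hN0, Real.rpow_one]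
  ring
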